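/- For every integer n ≥ 7, the only 3-dimensional subspaces of H₃ invariant under the substitution action of R_{2π/n} are A₁₂₃, A₁₄₅, and A₁₆₇. -/

import Mathlib

noncomputable section

open MvPolynomial Matrix

/-- The polynomial ring `ℝ[x,y,z]`. -/
abbrev P3 := MvPolynomial (Fin 3) ℝ

/-- `SO(3)`, realised as a set of real 3×3 matrices. -/
def SO3 : Set (Matrix (Fin 3) (Fin 3) ℝ) := {A | A * Aᵀ = 1 ∧ A.det = 1}

/-- The substitution action of a matrix `A` on polynomials: `(A · p)(w) = p (A⁻¹ w)`,
i.e. the variable `Xᵢ` is replaced by `∑ⱼ (A⁻¹)ᵢⱼ Xⱼ`. -/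
def sAct (A : Matrix (Fin 3) (Fin 3) ℝ) (p : P3) : P3 :=
  aeval (fun i => ∑ j, A⁻¹ i j • (X j : P3)) p

/-- The Laplace operator on polynomials in three variables. -/
def lap : P3 →ₗ[ℝ] P3 :=
  ∑ i : Fin 3, ((pderiv i).toLinearMap ∘ₗ (pderiv i).toLinearMap)

/-- `H₃`: the space of harmonic homogeneous cubic polynomials in `x, y, z`. -/
def H3 : Submodule ℝ P3 :=
  homogeneousSubmodule (Fin 3) ℝ 3 ⊓ LinearMap.ker lap

/-- The orthonormal basis `e₁, …, e₇` of `H₃` (with `x = X 0`, `y = X 1`, `z = X 2`). -/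
def eH : Fin 7 → P3 :=
  ![(1 / 5 : ℝ) • (X 0 * (2 * X 0 ^ 2 - 3 * X 1 ^ 2 - 3 * X 2 ^ 2)),
    (Real.sqrt 6 / 10) • (X 2 * (4 * X 0 ^ 2 - X 1 ^ 2 - X 2 ^ 2)),
    (Real.sqrt 6 / 10) • (X 1 * (4 * X 0 ^ 2 - X 1 ^ 2 - X 2 ^ 2)),
    (2 * Real.sqrt 15 / 5) • (X 0 * X 1 * X 2),
    (Real.sqrt 15 / 5) • (X 0 * (X 1 ^ 2 - X 2 ^ 2)),
    (Real.sqrt 10 / 10) • (X 2 * (3 * X 1 ^ 2 - X 2 ^ 2)),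
    (Real.sqrt 10 / 10) • (X 1 * (X 1 ^ 2 - 3 * X 2 ^ 2))]

/-- The identification of `ℝ⁷` (coordinates) with `H₃`, via the basis `e₁, …, e₇`. -/
def iotaH (v : Fin 7 → ℝ) : P3 := ∑ i, v i • eH i

/-- The subset of `H₃` corresponding to a coordinate subspace `E ⊆ ℝ⁷`. -/
def polySet (E : Submodule ℝ (Fin 7 → ℝ)) : Set P3 := iotaH '' (E : Set (Fin 7 → ℝ))

/-- The inner product of `H₃` making `e₁, …, e₇` orthonormal, in coordinates. -/
def dot7 (u v : Fin 7 → ℝ) : ℝ := ∑ i, u i * v i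

/-- The 3×3 minor determinant `(eⁱ ∧ eʲ ∧ eᵏ) (u, v, w)`. -/
def triD (u v w : Fin 7 → ℝ) (i j k : Fin 7) : ℝ :=
  Matrix.det !![u i, u j, u k; v i, v j, v k; w i, w j, w k]

/-- The 3-form `φ₀ = e¹²³ + e¹⁴⁵ − e¹⁶⁷ + e²⁴⁶ + e²⁵⁷ + e³⁴⁷ − e³⁵⁶`, in coordinates
(indices shifted by one: `eᵢ = e (i-1)`). -/
def phi0 (u v w : Fin 7 → ℝ) : ℝ :=
  triD u v w 0 1 2 + triD u v w 0 3 4 - triD u v w 0 5 6 + triD u v w 1 3 5 +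
    triD u v w 1 4 6 + triD u v w 2 3 6 - triD u v w 2 4 5

/-- A 3-dimensional subspace `E` of `H₃` (in coordinates) is associative if it has an
orthonormal basis `(u, v, w)` with `φ₀ (u, v, w) = ±1`. -/
def IsAssocSubspace (E : Submodule ℝ (Fin 7 → ℝ)) : Prop :=
  ∃ u v w : Fin 7 → ℝ, u ∈ E ∧ v ∈ E ∧ w ∈ E ∧
    dot7 u u = 1 ∧ dot7 v v = 1 ∧ dot7 w w = 1 ∧
    dot7 u v = 0 ∧ dot7 u w = 0 ∧ dot7 v w = 0 ∧
    Submodule.span ℝ {u, v, w} = E ∧ (phi0 u v w = 1 ∨ phi0 u v w = -1)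

/-- The subspace `E ⊆ H₃` is invariant under the substitution action of `A`: `A · E = E`. -/
def InvUnder (A : Matrix (Fin 3) (Fin 3) ℝ) (E : Submodule ℝ (Fin 7 → ℝ)) : Prop :=
  sAct A '' polySet E = polySet E

/-- The `SO(3)`-stabiliser of a subspace `E ⊆ H₃`: `{A ∈ SO(3) | A · E = E}`. -/
def stabSO3 (E : Submodule ℝ (Fin 7 → ℝ)) : Set (Matrix (Fin 3) (Fin 3) ℝ) :=
  {A | A ∈ SO3 ∧ InvUnder A E}

/-- The subset `S` of a monoid is a subgroup isomorphic to the group `G`. -/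
def SetIsoGroup {M : Type*} [Monoid M] (S : Set M) (G : Type*) [Group G] : Prop :=
  ∃ f : G → M, Function.Injective f ∧ (∀ a b, f (a * b) = f a * f b) ∧ Set.range f = S

/-- The rotation `R_α` about the x-axis through the angle `α`. -/
def Rmat (α : ℝ) : Matrix (Fin 3) (Fin 3) ℝ :=
  !![1, 0, 0; 0, Real.cos α, -Real.sin α; 0, Real.sin α, Real.cos α]

/-- `A₁₂₃ = span (e₁, e₂, e₃)`, in coordinates. -/
def A123 : Submodule ℝ (Fin 7 → ℝ) :=
  Submodule.span ℝ {![1, 0, 0, 0, 0, 0, 0], ![0, 1, 0, 0, 0, 0, 0], ![0, 0, 1, 0, 0, 0, 0]}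

/-- `A₁₄₅ = span (e₁, e₄, e₅)`, in coordinates. -/
def A145 : Submodule ℝ (Fin 7 → ℝ) :=
  Submodule.span ℝ {![1, 0, 0, 0, 0, 0, 0], ![0, 0, 0, 1, 0, 0, 0], ![0, 0, 0, 0, 1, 0, 0]}

/-- `A₁₆₇ = span (e₁, e₆, e₇)`, in coordinates. -/
def A167 : Submodule ℝ (Fin 7 → ℝ) :=
  Submodule.span ℝ {![1, 0, 0, 0, 0, 0, 0], ![0, 0, 0, 0, 0, 1, 0], ![0, 0, 0, 0, 0, 0, 1]}

/-- The map on coordinates rotating the planes `⟨e₂, e₃⟩`, `⟨e₄, e₅⟩`, `⟨e₆, e₇⟩` by the angles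
whose cosines and sines are `c k`, `s k`. -/
def planeRot (c s : Fin 3 → ℝ) (v : Fin 7 → ℝ) : Fin 7 → ℝ :=
  ![v 0, c 0 * v 1 + s 0 * v 2, -s 0 * v 1 + c 0 * v 2, c 1 * v 3 + s 1 * v 4,
    -s 1 * v 3 + c 1 * v 4, c 2 * v 5 + s 2 * v 6, -s 2 * v 5 + c 2 * v 6]

theorem Rmat_inv (α : ℝ) : (Rmat α)⁻¹ = Rmat (-α) := by
  apply Matrix.inv_eq_right_inv
  ext i j
  fin_cases i <;> fin_cases j <;>
    simp [Rmat, Matrix.mul_apply, Fin.sum_univ_three, ← sq] <;> ring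

theorem eval_iotaH (v : Fin 7 → ℝ) (w : Fin 3 → ℝ) :
    eval w (iotaH v) =
      v 0 * (1 / 5 * (w 0 * (2 * w 0 ^ 2 - 3 * w 1 ^ 2 - 3 * w 2 ^ 2))) +
      v 1 * (√6 / 10 * (w 2 * (4 * w 0 ^ 2 - w 1 ^ 2 - w 2 ^ 2))) +
      v 2 * (√6 / 10 * (w 1 * (4 * w 0 ^ 2 - w 1 ^ 2 - w 2 ^ 2))) +
      v 3 * (2 * √15 / 5 * (w 0 * w 1 * w 2)) +
      v 4 * (√15 / 5 * (w 0 * (w 1 ^ 2 - w 2 ^ 2))) +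
      v 5 * (√10 / 10 * (w 2 * (3 * w 1 ^ 2 - w 2 ^ 2))) +
      v 6 * (√10 / 10 * (w 1 * (w 1 ^ 2 - 3 * w 2 ^ 2))) := by
  simp [iotaH, eH, Fin.sum_univ_succ, MvPolynomial.smul_eval, eval_ofNat]
  ring

theorem eval_sAct (A : Matrix (Fin 3) (Fin 3) ℝ) (p : P3) (w : Fin 3 → ℝ) :
    eval w (sAct A p) = eval (A⁻¹ *ᵥ w) p := by
  induction p using MvPolynomial.induction_on with
  | C a => simp [sAct]
  | add p q hp hq => simp_all [sAct]
  | mul_X p i hp =>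
    rw [sAct] at hp ⊢
    rw [map_mul, map_mul, hp, map_mul, aeval_X, eval_X]
    simp [Matrix.mulVec, dotProduct, MvPolynomial.smul_eval]

theorem sAct_Rmat_iotaH (α : ℝ) (v : Fin 7 → ℝ) :
    sAct (Rmat α) (iotaH v) =
      iotaH (planeRot ![Real.cos α, Real.cos (2 * α), Real.cos (3 * α)]
        ![Real.sin α, Real.sin (2 * α), Real.sin (3 * α)] v) := by
  apply MvPolynomial.funext
  intro w
  have h0 : (Rmat (-α) *ᵥ w) 0 = w 0 := by
    simp [Rmat, Matrix.mulVec, dotProduct, Fin.sum_univ_three]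
  have h1 : (Rmat (-α) *ᵥ w) 1 = Real.cos α * w 1 + Real.sin α * w 2 := by
    simp [Rmat, Matrix.mulVec, dotProduct, Fin.sum_univ_three]
  have h2 : (Rmat (-α) *ᵥ w) 2 = -Real.sin α * w 1 + Real.cos α * w 2 := by
    simp [Rmat, Matrix.mulVec, dotProduct, Fin.sum_univ_three]
  have hc3 : Real.cos (3 * α) = Real.cos α ^ 3 - 3 * Real.cos α * Real.sin α ^ 2 := by
    rw [Real.cos_three_mul]
    linear_combination 3 * Real.cos α * Real.sin_sq_add_cos_sq α
  have hs3 : Real.sin (3 * α) = 3 * Real.cos α ^ 2 * Real.sin α - Real.sin α ^ 3 := by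
    rw [Real.sin_three_mul]
    linear_combination -3 * Real.sin α * Real.sin_sq_add_cos_sq α
  rw [eval_sAct, Rmat_inv, eval_iotaH, eval_iotaH, h0, h1, h2]
  simp only [planeRot, Real.cos_two_mul', Real.sin_two_mul, hc3, hs3, Matrix.cons_val]
  linear_combination
    (-(3 / 5) * v 0 * w 0 * (w 1 ^ 2 + w 2 ^ 2) -
      v 1 * (√6 / 10) * (w 1 ^ 2 + w 2 ^ 2) * (-Real.sin α * w 1 + Real.cos α * w 2) -
      v 2 * (√6 / 10) * (w 1 ^ 2 + w 2 ^ 2) * (Real.cos α * w 1 + Real.sin α * w 2)) *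
      Real.sin_sq_add_cos_sq α

theorem iotaH_injective : Function.Injective iotaH := by
  intro u v h
  have key (x y z : ℝ) := congrArg (eval ![x, y, z]) h
  simp only [eval_iotaH, Matrix.cons_val] at key
  have h6 : √6 ≠ 0 := by positivity
  have h10 : √10 ≠ 0 := by positivity
  have h15 : √15 ≠ 0 := by positivity
  have e0 : u 0 = v 0 := by linear_combination (5 / 2) * key 1 0 0
  have e1 : √6 * u 1 = √6 * v 1 := by
    linear_combination (5 / 4) * (key 1 0 1 + key (-1) 0 1) - (5 / 2) * key 0 0 1
  have e2 : √6 * u 2 = √6 * v 2 := by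
    linear_combination (5 / 4) * (key 1 1 0 + key (-1) 1 0) - (5 / 2) * key 0 1 0
  have e3 : √15 * u 3 = √15 * v 3 := by
    linear_combination (5 / 4) * (key 1 1 1 - key (-1) 1 1) + 2 * e0
  have e4 : √15 * u 4 = √15 * v 4 := by
    linear_combination (-5 / 2) * (key 1 0 1 - key (-1) 0 1) - e0
  have e5 : √10 * u 5 = √10 * v 5 := by linear_combination -10 * key 0 0 1 - e1
  have e6 : √10 * u 6 = √10 * v 6 := by linear_combination 10 * key 0 1 0 + e2
  ext i
  fin_cases i
  exacts [e0, mul_left_cancel₀ h6 e1, mul_left_cancel₀ h6 e2, mul_left_cancel₀ h15 e3,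
    mul_left_cancel₀ h15 e4, mul_left_cancel₀ h10 e5, mul_left_cancel₀ h10 e6]

theorem planeRot_invariant {α : ℝ} {E : Submodule ℝ (Fin 7 → ℝ)} (hE : InvUnder (Rmat α) E)
    {v : Fin 7 → ℝ} (hv : v ∈ E) :
    planeRot ![Real.cos α, Real.cos (2 * α), Real.cos (3 * α)]
      ![Real.sin α, Real.sin (2 * α), Real.sin (3 * α)] v ∈ E := by
  have h : sAct (Rmat α) (iotaH v) ∈ polySet E :=
    hE ▸ Set.mem_image_of_mem _ (Set.mem_image_of_mem _ hv)
  rw [sAct_Rmat_iotaH] at h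
  obtain ⟨w, hw, hwv⟩ := h
  exact iotaH_injective hwv ▸ hw

section Invariant

variable {c s : Fin 3 → ℝ} {E : Submodule ℝ (Fin 7 → ℝ)}

/-- The quadratic polynomial `T² - 2 t T + 1` applied to a vector, where `T = planeRot c s`. -/
def quadRot (c s : Fin 3 → ℝ) (t : ℝ) (v : Fin 7 → ℝ) : Fin 7 → ℝ :=
  planeRot c s (planeRot c s v) - (2 * t) • planeRot c s v + v

theorem quadRot_mem (hE : ∀ v ∈ E, planeRot c s v ∈ E) (t : ℝ) {v : Fin 7 → ℝ} (hv : v ∈ E) :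
    quadRot c s t v ∈ E :=
  E.add_mem (E.sub_mem (hE _ (hE _ hv)) (E.smul_mem _ (hE _ hv))) hv

theorem quadRot_apply_zero (t : ℝ) (v : Fin 7 → ℝ) :
    quadRot c s t v 0 = 2 * (1 - t) * v 0 := by
  simp [quadRot, planeRot]
  ring

/-- The first index of the `k`-th rotation plane. -/
def lo : Fin 3 → Fin 7 := ![1, 3, 5]

/-- The second index of the `k`-th rotation plane. -/
def hi : Fin 3 → Fin 7 := ![2, 4, 6]

theorem planeRot_lo (k : Fin 3) (v : Fin 7 → ℝ) :
    planeRot c s v (lo k) = c k * v (lo k) + s k * v (hi k) := by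
  fin_cases k <;> rfl

theorem planeRot_hi (k : Fin 3) (v : Fin 7 → ℝ) :
    planeRot c s v (hi k) = -s k * v (lo k) + c k * v (hi k) := by
  fin_cases k <;> rfl

theorem quadRot_lo (h1 : ∀ k, c k ^ 2 + s k ^ 2 = 1) (t : ℝ) (k : Fin 3) (v : Fin 7 → ℝ) :
    quadRot c s t v (lo k) = 2 * (c k - t) * planeRot c s v (lo k) := by
  simp only [quadRot, Pi.add_apply, Pi.sub_apply, Pi.smul_apply, smul_eq_mul, planeRot_lo,
    planeRot_hi]
  linear_combination -v (lo k) * h1 k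

theorem quadRot_hi (h1 : ∀ k, c k ^ 2 + s k ^ 2 = 1) (t : ℝ) (k : Fin 3) (v : Fin 7 → ℝ) :
    quadRot c s t v (hi k) = 2 * (c k - t) * planeRot c s v (hi k) := by
  simp only [quadRot, Pi.add_apply, Pi.sub_apply, Pi.smul_apply, smul_eq_mul, planeRot_lo,
    planeRot_hi]
  linear_combination -v (hi k) * h1 k

theorem quadRot_normSq (h1 : ∀ k, c k ^ 2 + s k ^ 2 = 1) (t : ℝ) (k : Fin 3) (v : Fin 7 → ℝ) :
    quadRot c s t v (lo k) ^ 2 + quadRot c s t v (hi k) ^ 2 =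
      (2 * (c k - t)) ^ 2 * (v (lo k) ^ 2 + v (hi k) ^ 2) := by
  rw [quadRot_lo h1, quadRot_hi h1, planeRot_lo, planeRot_hi]
  linear_combination (2 * (c k - t)) ^ 2 * (v (lo k) ^ 2 + v (hi k) ^ 2) * h1 k

theorem quadRot_self_lo (h1 : ∀ k, c k ^ 2 + s k ^ 2 = 1) (k : Fin 3) (v : Fin 7 → ℝ) :
    quadRot c s (c k) v (lo k) = 0 := by
  simp [quadRot_lo h1]

theorem quadRot_self_hi (h1 : ∀ k, c k ^ 2 + s k ^ 2 = 1) (k : Fin 3) (v : Fin 7 → ℝ) :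
    quadRot c s (c k) v (hi k) = 0 := by
  simp [quadRot_hi h1]

theorem quadRot_eq_zero (h1 : ∀ k, c k ^ 2 + s k ^ 2 = 1) (t : ℝ) (k : Fin 3) {v : Fin 7 → ℝ}
    (hlo : v (lo k) = 0) (hhi : v (hi k) = 0) :
    quadRot c s t v (lo k) = 0 ∧ quadRot c s t v (hi k) = 0 := by
  simp [quadRot_lo h1, quadRot_hi h1, planeRot_lo, planeRot_hi, hlo, hhi]

theorem eq_zero_or_lo_or_hi (i : Fin 7) : i = 0 ∨ ∃ k, i = lo k ∨ i = hi k := by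
  revert i
  decide

theorem single_zero_mem (hE : ∀ v ∈ E, planeRot c s v ∈ E) (h1 : ∀ k, c k ^ 2 + s k ^ 2 = 1)
    (hc1 : ∀ k, c k ≠ 1) {v : Fin 7 → ℝ} (hv : v ∈ E) (h : v 0 ≠ 0) :
    Pi.single 0 1 ∈ E := by
  set w := quadRot c s (c 0) (quadRot c s (c 1) (quadRot c s (c 2) v)) with hw
  have hwE : w ∈ E := quadRot_mem hE _ (quadRot_mem hE _ (quadRot_mem hE _ hv))
  have hw0 : w 0 ≠ 0 := by
    simp only [hw, quadRot_apply_zero]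
    have := fun k => sub_ne_zero.2 (hc1 k).symm
    simp [this, h]
  have hk : ∀ k, w (lo k) = 0 ∧ w (hi k) = 0 := by
    intro k
    fin_cases k
    · exact ⟨quadRot_self_lo h1 _ _, quadRot_self_hi h1 _ _⟩
    · exact quadRot_eq_zero h1 _ _ (quadRot_self_lo h1 _ _) (quadRot_self_hi h1 _ _)
    · have := quadRot_eq_zero h1 (c 1) 2 (quadRot_self_lo h1 2 v) (quadRot_self_hi h1 2 v)
      exact quadRot_eq_zero h1 _ _ this.1 this.2
  have : w = w 0 • Pi.single 0 1 := by
    ext i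
    obtain rfl | ⟨k, rfl | rfl⟩ := eq_zero_or_lo_or_hi i
    · simp
    · rw [(hk k).1]; fin_cases k <;> simp [lo]
    · rw [(hk k).2]; fin_cases k <;> simp [hi]
  rw [this] at hwE
  exact (E.smul_mem_iff hw0).1 hwE

theorem single_mem_of_supported (hE : ∀ v ∈ E, planeRot c s v ∈ E) (k : Fin 3) (hs : s k ≠ 0)
    {w : Fin 7 → ℝ} (hw : w ∈ E) (hne : w (lo k) ^ 2 + w (hi k) ^ 2 ≠ 0)
    (h0 : w 0 = 0) (hz : ∀ j ≠ k, w (lo j) = 0 ∧ w (hi j) = 0) :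
    Pi.single (lo k) 1 ∈ E ∧ Pi.single (hi k) 1 ∈ E := by
  have hdet : -s k * (w (lo k) ^ 2 + w (hi k) ^ 2) ≠ 0 := mul_ne_zero (neg_ne_zero.2 hs) hne
  have hT0 : planeRot c s w 0 = 0 := h0
  have hT : ∀ j ≠ k, planeRot c s w (lo j) = 0 ∧ planeRot c s w (hi j) = 0 := fun j hj => by
    simp [planeRot_lo, planeRot_hi, hz j hj]
  have hlo : Function.Injective lo := by decide
  have hhi : Function.Injective hi := by decide
  have hlh : ∀ i j, lo i ≠ hi j := by decide
  have hl0 : ∀ i, lo i ≠ 0 := by decide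
  have hh0 : ∀ i, hi i ≠ 0 := by decide
  constructor
  · refine (E.smul_mem_iff hdet).1 ?_
    convert E.sub_mem (E.smul_mem (planeRot c s w (hi k)) hw) (E.smul_mem (w (hi k)) (hE w hw))
      using 1
    ext i
    obtain rfl | ⟨j, rfl | rfl⟩ := eq_zero_or_lo_or_hi i
    · simp [h0, hT0, (hl0 k).symm]
    · by_cases hj : j = k
      · subst hj
        simp [planeRot_lo, planeRot_hi]
        ring
      · simp [hz j hj, hT j hj, hlo.ne hj]
    · by_cases hj : j = k
      · subst hj
        simp [(hlh _ _).symm, mul_comm]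
      · simp [hz j hj, hT j hj, (hlh _ _).symm]
  · refine (E.smul_mem_iff hdet).1 ?_
    convert E.sub_mem (E.smul_mem (w (lo k)) (hE w hw)) (E.smul_mem (planeRot c s w (lo k)) hw)
      using 1
    ext i
    obtain rfl | ⟨j, rfl | rfl⟩ := eq_zero_or_lo_or_hi i
    · simp [h0, hT0, (hh0 k).symm]
    · by_cases hj : j = k
      · subst hj
        simp [hlh, mul_comm]
      · simp [hz j hj, hT j hj, hlh]
    · by_cases hj : j = k
      · subst hj
        simp [planeRot_lo, planeRot_hi]
        ring
      · simp [hz j hj, hT j hj, hhi.ne hj]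

theorem single_lo_hi_mem (hE : ∀ v ∈ E, planeRot c s v ∈ E) (h1 : ∀ k, c k ^ 2 + s k ^ 2 = 1)
    (hs : ∀ k, s k ≠ 0) (hc1 : ∀ k, c k ≠ 1) (hc : Function.Injective c) (k : Fin 3)
    {v : Fin 7 → ℝ} (hv : v ∈ E) (h : v (lo k) ≠ 0 ∨ v (hi k) ≠ 0) :
    Pi.single (lo k) 1 ∈ E ∧ Pi.single (hi k) 1 ∈ E := by
  have hk : k ≠ k + 1 ∧ k ≠ k + 2 ∧ ∀ j, j ≠ k → j = k + 1 ∨ j = k + 2 := by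
    clear h
    revert k
    decide
  refine single_mem_of_supported hE k (hs k) (w := quadRot c s (c (k + 1))
    (quadRot c s (c (k + 2)) (quadRot c s 1 v)))
    (quadRot_mem hE _ (quadRot_mem hE _ (quadRot_mem hE _ hv))) ?_ ?_ ?_
  · simp only [quadRot_normSq h1]
    have hv2 : v (lo k) ^ 2 + v (hi k) ^ 2 ≠ 0 := by
      rcases h with h | h <;> positivity
    have a1 := sub_ne_zero.2 (hc.ne hk.1)
    have a2 := sub_ne_zero.2 (hc.ne hk.2.1)
    have a3 := sub_ne_zero.2 (hc1 k)
    positivity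
  · simp [quadRot_apply_zero]
  · intro j hj
    rcases hk.2.2 j hj with rfl | rfl
    · exact ⟨quadRot_self_lo h1 _ _, quadRot_self_hi h1 _ _⟩
    · exact quadRot_eq_zero h1 _ _ (quadRot_self_lo h1 _ _) (quadRot_self_hi h1 _ _)

end Invariant

/-- A subspace spanned by coordinate vectors is spanned by a set of them of size its
dimension. -/
theorem exists_eq_span_single {ι : Type*} [Fintype ι] [DecidableEq ι] {E : Submodule ℝ (ι → ℝ)}
    (h : ∀ v ∈ E, ∀ i, v i ≠ 0 → Pi.single i 1 ∈ E) :
    ∃ S : Finset ι, S.card = Module.finrank ℝ E ∧ (∀ i, i ∈ S ↔ Pi.single i 1 ∈ E) ∧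
      E = Submodule.span ℝ ((fun i => Pi.single i (1 : ℝ)) '' (S : Set ι)) := by
  classical
  let S : Finset ι := {i | Pi.single i (1 : ℝ) ∈ E}
  have hS : E = Submodule.span ℝ ((fun i => Pi.single i (1 : ℝ)) '' (S : Set ι)) := by
    apply le_antisymm
    · intro v hv
      rw [pi_eq_sum_univ' v]
      refine Submodule.sum_mem _ fun i _ => ?_
      by_cases hi : v i = 0
      · simp [hi]
      · exact Submodule.smul_mem _ _ (Submodule.subset_span
          ⟨i, by simpa [S] using h v hv i hi, by ext; simp [Pi.single_apply, eq_comm]⟩)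
    · rw [Submodule.span_le]
      rintro _ ⟨i, hi, rfl⟩
      simpa [S] using hi
  refine ⟨S, ?_, by simp [S], hS⟩
  have hli : LinearIndependent ℝ fun i : S => (Pi.single (i : ι) (1 : ℝ) : ι → ℝ) :=
    (Pi.linearIndependent_single_one ι ℝ).comp _ Subtype.val_injective
  rw [hS, Set.image_eq_range]
  simpa using (finrank_span_eq_card hli).symm

set_option maxRecDepth 100000 in
theorem card_three_of_pairs (S : Finset (Fin 7)) (hS : S.card = 3)
    (h : ∀ k, lo k ∈ S ↔ hi k ∈ S) : S = {0, 1, 2} ∨ S = {0, 3, 4} ∨ S = {0, 5, 6} := by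
  revert S
  decide

theorem cos_multiples_injective {α : ℝ} (h0 : 0 < α) (h3 : 3 * α < Real.pi) :
    Function.Injective ![Real.cos α, Real.cos (2 * α), Real.cos (3 * α)] := by
  have h12 : Real.cos (2 * α) < Real.cos α :=
    Real.cos_lt_cos_of_nonneg_of_le_pi h0.le (by linarith) (by linarith)
  have h23 : Real.cos (3 * α) < Real.cos (2 * α) :=
    Real.cos_lt_cos_of_nonneg_of_le_pi (by linarith) h3.le (by linarith)
  intro i j hij
  fin_cases i <;> fin_cases j <;> simp at hij ⊢ <;> linarith

/-- For every `n ≥ 7`, the only 3-dimensional subspaces of `H₃` invariant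
under the substitution action of `R_{2π/n}` are `A₁₂₃`, `A₁₄₅` and `A₁₆₇`. -/
theorem stmt12 (n : ℕ) (hn : 7 ≤ n) (E : Submodule ℝ (Fin 7 → ℝ))
    (hdim : Module.finrank ℝ E = 3) (hinv : InvUnder (Rmat (2 * Real.pi / n)) E) :
    E = A123 ∨ E = A145 ∨ E = A167 := by
  have hn' : (7 : ℝ) ≤ n := by exact_mod_cast hn
  set α := 2 * Real.pi / n with hα
  have h0 : 0 < α := by positivity
  have h3 : 3 * α < Real.pi := by
    rw [hα, ← mul_div_assoc, div_lt_iff₀ (by linarith)]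
    nlinarith [Real.pi_pos]
  set c : Fin 3 → ℝ := ![Real.cos α, Real.cos (2 * α), Real.cos (3 * α)] with hc
  set s : Fin 3 → ℝ := ![Real.sin α, Real.sin (2 * α), Real.sin (3 * α)] with hs
  have hE : ∀ v ∈ E, planeRot c s v ∈ E := fun v hv => planeRot_invariant hinv hv
  have h1 : ∀ k, c k ^ 2 + s k ^ 2 = 1 := by
    intro k
    fin_cases k <;> exact Real.cos_sq_add_sin_sq _
  have hs0 : ∀ k, s k ≠ 0 := by
    intro k
    fin_cases k <;> exact (Real.sin_pos_of_pos_of_lt_pi (by linarith) (by linarith)).ne'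
  have hc1 : ∀ k, c k ≠ 1 := fun k hk => hs0 k (by simpa [hk] using h1 k)
  have hpair := single_lo_hi_mem hE h1 hs0 hc1 (cos_multiples_injective h0 h3)
  obtain ⟨S, hcard, hmem, hspan⟩ := exists_eq_span_single (E := E) fun v hv i hvi => by
    obtain rfl | ⟨k, rfl | rfl⟩ := eq_zero_or_lo_or_hi i
    · exact single_zero_mem hE h1 hc1 hv hvi
    · exact (hpair k hv (.inl hvi)).1
    · exact (hpair k hv (.inr hvi)).2
  rcases card_three_of_pairs S (hcard.trans hdim) fun k => by
    rw [hmem, hmem]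
    exact ⟨fun h => (hpair k h (.inl (by simp))).2, fun h => (hpair k h (.inr (by simp))).1⟩
    with rfl | rfl | rfl
  · left
    rw [hspan, A123]
    simp only [Finset.coe_insert, Finset.coe_singleton, Set.image_insert_eq, Set.image_singleton]
    congr! 3 <;> (try congr! 1) <;> ext i <;> fin_cases i <;> rfl
  · right
    left
    rw [hspan, A145]
    simp only [Finset.coe_insert, Finset.coe_singleton, Set.image_insert_eq, Set.image_singleton]
    congr! 3 <;> (try congr! 1) <;> ext i <;> fin_cases i <;> rfl
  · right
    right
    rw [hspan, A167]
    simp only [Finset.coe_insert, Finset.coe_singleton, Set.image_insert_eq, Set.image_singleton]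
    congr! 3 <;> (try congr! 1) <;> ext i <;> fin_cases i <;> rfl
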